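/- arXiv:0908.3850 — 3 statements merged into one kernel-verified Lean document; each statement's English description precedes it below -/
import Mathlib

section
/- Let G = (V,E) be a finite simple graph and let β be a real number with β ≠ 0 and β ≠ 1. Then Σ_{s ⊆ E, every vertex has even degree in (V,s)} β^{|s|} = (1-β)^{n(G)} · β^{r(G)} · Σ_{s ⊆ E} (1/β - 1)^{r(G)-r(s)} · (2β/(1-β))^{n(s)}, where k(s) is the number of connected components of the spanning subgraph (V,s), r(s) = |V| - k(s), n(s) = |s| - |V| + k(s), r(G) = r(E), and n(G) = n(E). (This states θ_G(β,0) = (1-β)^{n(G)} β^{r(G)} T_G(1/β, (1+β)/(1-β)), where T_G is the Tutte polynomial given by its subset expansion.) -/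
open Polynomial

attribute [local instance] Classical.propDecidable

/-- The degree of vertex `i` in the spanning subgraph `(V, s)`. -/
noncomputable def degIn {V : Type*} (s : Finset (Sym2 V)) (i : V) : ℕ :=
  (s.filter (fun e => i ∈ e)).card

/-- The spanning subgraph `(V, s)` determined by an edge set `s`. -/
noncomputable def subSpan {V : Type*} (s : Finset (Sym2 V)) : SimpleGraph V :=
  SimpleGraph.fromEdgeSet ↑s

/-- `k(s)`: the number of connected components of the spanning subgraph `(V, s)`. -/
noncomputable def numComp {V : Type*} (s : Finset (Sym2 V)) : ℕ :=
  Nat.card (subSpan s).ConnectedComponent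

/-- The rank `r(s) = |V| − k(s)` of the spanning subgraph `(V, s)`. -/
noncomputable def rankS {V : Type*} [Fintype V] (s : Finset (Sym2 V)) : ℕ :=
  Fintype.card V - numComp s

/-- The nullity `n(s) = |s| − |V| + k(s)` of the spanning subgraph `(V, s)`. -/
noncomputable def nullS {V : Type*} [Fintype V] (s : Finset (Sym2 V)) : ℕ :=
  s.card + numComp s - Fintype.card V

theorem sum_units_pow (d : ℕ) : ∑ ε : ℤˣ, ((ε : ℤ)) ^ d = if Even d then 2 else 0 := by
  rw [UnitsInt.univ]
  split_ifs with h
  · simp [h.neg_one_pow]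
  · simp [(Nat.not_even_iff_odd.mp h).neg_one_pow]

/-- The functions constant along the edges of a graph are the functions on its components. -/
noncomputable def edgeInvariantEquiv {V : Type*} (H : SimpleGraph V) (α : Type*) :
    {σ : V → α // ∀ a b, H.Adj a b → σ a = σ b} ≃ (H.ConnectedComponent → α) where
  toFun σ := SimpleGraph.ConnectedComponent.lift σ.1 (fun v w p _ => by
    induction p with
    | nil => rfl
    | cons h _ ih => exact (σ.2 _ _ h).trans (ih (by simp_all)))
  invFun τ := ⟨fun v => τ (H.connectedComponentMk v), fun a b h => by
    exact congrArg τ (SimpleGraph.ConnectedComponent.sound h.reachable)⟩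
  left_inv σ := by ext; rfl
  right_inv τ := by
    ext c
    induction c using SimpleGraph.ConnectedComponent.ind
    rfl

/-- The product of a sign assignment over the endpoints of an edge. -/
noncomputable def edgeSign {V : Type*} [Fintype V] (σ : V → ℤˣ) (e : Sym2 V) : ℤ :=
  ∏ v with v ∈ e, (σ v : ℤ)

theorem one_add_edgeSign {V : Type*} [Fintype V] (σ : V → ℤˣ) {a b : V} (hab : a ≠ b) :
    1 + edgeSign σ s(a, b) = if σ a = σ b then 2 else 0 := by
  have h : (Finset.univ.filter fun v => v ∈ s(a, b)) = {a, b} := by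
    ext v
    simp
  rw [edgeSign, h, Finset.prod_pair hab]
  rcases Int.units_eq_one_or (σ a) with ha | ha <;>
    rcases Int.units_eq_one_or (σ b) with hb | hb <;> simp [ha, hb]

theorem prod_edgeSign {V : Type*} [Fintype V] (σ : V → ℤˣ) (t : Finset (Sym2 V)) :
    ∏ e ∈ t, edgeSign σ e = ∏ v, (σ v : ℤ) ^ degIn t v := by
  simp only [edgeSign, degIn, Finset.prod_filter, ← Finset.prod_const]
  exact Finset.prod_comm

theorem prod_one_add_edgeSign {V : Type*} [Fintype V] (σ : V → ℤˣ) (s : Finset (Sym2 V))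
    (hs : ∀ e ∈ s, ¬ e.IsDiag) :
    ∏ e ∈ s, (1 + edgeSign σ e)
      = if ∀ a b, (subSpan s).Adj a b → σ a = σ b then 2 ^ s.card else 0 := by
  split_ifs with h
  · rw [← Finset.prod_const]
    refine Finset.prod_congr rfl fun e he => ?_
    induction e with
    | _ a b =>
      have hab : a ≠ b := by simpa using hs _ he
      rw [one_add_edgeSign σ hab, if_pos (h a b (by simp [subSpan, he, hab]))]
  · push Not at h
    obtain ⟨a, b, hab, hσ⟩ := h
    simp only [subSpan, SimpleGraph.fromEdgeSet_adj, Finset.mem_coe] at hab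
    exact Finset.prod_eq_zero hab.1 (by rw [one_add_edgeSign σ hab.2, if_neg hσ])

/-- The number of even subgraphs of a loopless `(V, s)`, up to powers of two. -/
theorem two_pow_card_mul_card_even {V : Type*} [Fintype V] (s : Finset (Sym2 V))
    (hs : ∀ e ∈ s, ¬ e.IsDiag) :
    2 ^ Fintype.card V * (s.powerset.filter fun t => ∀ i, Even (degIn t i)).card
      = 2 ^ (s.card + numComp s) := by
  have hsum : ∀ t : Finset (Sym2 V), ∑ σ : V → ℤˣ, ∏ e ∈ t, edgeSign σ e
      = if ∀ i, Even (degIn t i) then 2 ^ Fintype.card V else 0 := fun t => by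
    simp only [prod_edgeSign]
    rw [← Fintype.prod_sum fun v (ε : ℤˣ) => (ε : ℤ) ^ degIn t v]
    simp only [sum_units_pow]
    split_ifs with h
    · simp [h]
    · push Not at h
      obtain ⟨i, hi⟩ := h
      exact Finset.prod_eq_zero (Finset.mem_univ i) (if_neg (by simpa using hi))
  have hcard : (Finset.univ.filter fun σ : V → ℤˣ =>
      ∀ a b, (subSpan s).Adj a b → σ a = σ b).card = 2 ^ numComp s := by
    rw [← Fintype.card_subtype, ← Nat.card_eq_fintype_card,
      Nat.card_congr (edgeInvariantEquiv (subSpan s) ℤˣ), Nat.card_fun, numComp]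
    simp
  have key : ∑ σ : V → ℤˣ, ∏ e ∈ s, (1 + edgeSign σ e)
      = ∑ t ∈ s.powerset, ∑ σ : V → ℤˣ, ∏ e ∈ t, edgeSign σ e := by
    rw [Finset.sum_comm]
    exact Finset.sum_congr rfl fun σ _ => Finset.prod_one_add s
  simp only [hsum, prod_one_add_edgeSign _ s hs, ← Finset.sum_filter, Finset.sum_const, hcard,
    nsmul_eq_mul] at key
  zify
  rw [pow_add, mul_comm, ← key]
  push_cast
  ring

theorem numComp_anti {V : Type*} [Fintype V] {s t : Finset (Sym2 V)} (h : s ⊆ t) :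
    numComp t ≤ numComp s :=
  Nat.card_le_card_of_surjective _ (SimpleGraph.ConnectedComponent.surjective_map_ofLE
    (SimpleGraph.fromEdgeSet_mono (Finset.coe_subset.mpr h)))

theorem numComp_le_card {V : Type*} [Fintype V] (s : Finset (Sym2 V)) :
    numComp s ≤ Fintype.card V := by
  rw [← Nat.card_eq_fintype_card]
  exact Nat.card_le_card_of_surjective _ Quot.mk_surjective

theorem card_le_card_add_numComp {V : Type*} [Fintype V] (s : Finset (Sym2 V))
    (hs : ∀ e ∈ s, ¬ e.IsDiag) : Fintype.card V ≤ s.card + numComp s :=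
  (Nat.pow_dvd_pow_iff_le_right (by norm_num : 1 < 2)).mp
    (Dvd.intro _ (two_pow_card_mul_card_even s hs))

/-- A loopless `(V, s)` has `2 ^ n(s)` even subgraphs. -/
theorem card_even_eq_two_pow_nullS {V : Type*} [Fintype V] (s : Finset (Sym2 V))
    (hs : ∀ e ∈ s, ¬ e.IsDiag) :
    (s.powerset.filter fun t => ∀ i, Even (degIn t i)).card = 2 ^ nullS s := by
  refine Nat.eq_of_mul_eq_mul_left (pow_pos two_pos (Fintype.card V)) ?_
  rw [two_pow_card_mul_card_even s hs, ← pow_add, nullS,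
    Nat.add_sub_of_le (card_le_card_add_numComp s hs)]

theorem rankS_add_nullS {V : Type*} [Fintype V] (s : Finset (Sym2 V))
    (hs : ∀ e ∈ s, ¬ e.IsDiag) : rankS s + nullS s = s.card := by
  have := numComp_le_card s
  have := card_le_card_add_numComp s hs
  unfold rankS nullS
  omega

theorem rankS_mono {V : Type*} [Fintype V] {s t : Finset (Sym2 V)} (h : s ⊆ t) :
    rankS s ≤ rankS t :=
  Nat.sub_le_sub_left (numComp_anti h) _

/-- Each term of the subset expansion, after multiplying by the prefactor. -/
theorem prefactor_mul_term {β : ℝ} (hβ0 : β ≠ 0) (hβ1 : β ≠ 1) {r n R N : ℕ}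
    (hr : r ≤ R) (hle : r + n ≤ R + N) :
    (1 - β) ^ N * β ^ R * ((1 / β - 1) ^ (R - r) * (2 * β / (1 - β)) ^ n)
      = 2 ^ n * (β ^ (r + n) * (1 - β) ^ (R + N - (r + n))) := by
  have h1 : 1 - β ≠ 0 := sub_ne_zero.mpr hβ1.symm
  obtain ⟨d, rfl⟩ := Nat.exists_eq_add_of_le hr
  obtain ⟨m, hm⟩ := Nat.exists_eq_add_of_le hle
  rw [show 1 / β - 1 = (1 - β) / β by field_simp, hm, Nat.add_sub_cancel_left,
    Nat.add_sub_cancel_left, div_pow, div_pow, mul_pow]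
  have hd : (1 - β) ^ N * (1 - β) ^ d = (1 - β) ^ n * (1 - β) ^ m := by
    rw [← pow_add, ← pow_add]
    congr 1
    omega
  field_simp
  linear_combination β ^ (r + d + n) * hd

theorem sum_superset_weight {α : Type*} (β : ℝ) {t E : Finset α} (ht : t ⊆ E) :
    ∑ s ∈ E.powerset with t ⊆ s, β ^ s.card * (1 - β) ^ (E.card - s.card) = β ^ t.card := by
  have h : ∑ u ∈ (E \ t).powerset, β ^ u.card * (1 - β) ^ ((E \ t).card - u.card) = 1 := by
    rw [Finset.sum_pow_mul_eq_add_pow]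
    simp
  refine Eq.trans ?_ ((congrArg (β ^ t.card * ·) h).trans (mul_one _))
  simp only [Finset.mul_sum]
  refine Finset.sum_bij' (fun s _ => s \ t) (fun u _ => t ∪ u) ?_ ?_ ?_ ?_ ?_
  · intro s hs
    simp only [Finset.mem_filter, Finset.mem_powerset] at hs ⊢
    exact Finset.sdiff_subset_sdiff hs.1 subset_rfl
  · intro u hu
    simp only [Finset.mem_filter, Finset.mem_powerset] at hu ⊢
    exact ⟨Finset.union_subset ht (hu.trans Finset.sdiff_subset), Finset.subset_union_left⟩
  · intro s hs
    simp only [Finset.mem_filter, Finset.mem_powerset] at hs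
    exact Finset.union_sdiff_of_subset hs.2
  · intro u hu
    simp only [Finset.mem_powerset] at hu
    exact Finset.union_sdiff_cancel_left (Finset.disjoint_sdiff.mono_right hu)
  · intro s hs
    simp only [Finset.mem_filter, Finset.mem_powerset] at hs
    have h1 := Finset.card_sdiff_add_card_eq_card hs.2
    have h2 := Finset.card_sdiff_add_card_eq_card ht
    rw [← mul_assoc, ← pow_add, show t.card + (s \ t).card = s.card by omega,
      show (E \ t).card - (s \ t).card = E.card - s.card by omega]

theorem theta_gamma_zero_eq_Tutte {V : Type*} [Fintype V] [DecidableEq V]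
    (G : SimpleGraph V) [DecidableRel G.Adj] (β : ℝ) (hβ0 : β ≠ 0) (hβ1 : β ≠ 1) :
    ∑ s ∈ G.edgeFinset.powerset.filter (fun s => ∀ i : V, Even (degIn s i)), β ^ s.card
      = (1 - β) ^ nullS G.edgeFinset * β ^ rankS G.edgeFinset *
          ∑ s ∈ G.edgeFinset.powerset,
            (1 / β - 1) ^ (rankS G.edgeFinset - rankS s) * (2 * β / (1 - β)) ^ nullS s := by
  have hE : ∀ e ∈ G.edgeFinset, ¬ e.IsDiag := fun e he =>
    G.not_isDiag_of_mem_edgeFinset he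
  generalize G.edgeFinset = E at hE ⊢
  have hterm : ∀ s ∈ E.powerset,
      (1 - β) ^ nullS E * β ^ rankS E *
          ((1 / β - 1) ^ (rankS E - rankS s) * (2 * β / (1 - β)) ^ nullS s)
        = ∑ t ∈ s.powerset with ∀ i, Even (degIn t i),
            β ^ s.card * (1 - β) ^ (E.card - s.card) := fun s hs => by
    have hsE := Finset.mem_powerset.mp hs
    have hs' : ∀ e ∈ s, ¬ e.IsDiag := fun e he => hE e (hsE he)
    have hle := Finset.card_le_card hsE
    rw [← rankS_add_nullS s hs', ← rankS_add_nullS E hE] at hle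
    rw [prefactor_mul_term hβ0 hβ1 (rankS_mono hsE) hle, rankS_add_nullS s hs',
      rankS_add_nullS E hE, Finset.sum_const, card_even_eq_two_pow_nullS s hs', nsmul_eq_mul]
    push_cast
    rfl
  rw [Finset.mul_sum, Finset.sum_congr rfl hterm,
    Finset.sum_comm' (t' := E.powerset.filter fun t => ∀ i, Even (degIn t i))
      (s' := fun t => E.powerset.filter fun s => t ⊆ s)]
  · refine Finset.sum_congr rfl fun t ht => ?_
    convert (sum_superset_weight β (Finset.mem_powerset.mp (Finset.mem_filter.mp ht).1)).symm
  · intro s t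
    simp only [Finset.mem_filter, Finset.mem_powerset]
    exact ⟨fun ⟨h1, h2, h3⟩ => ⟨⟨h1, h2⟩, h2.trans h1, h3⟩, fun ⟨⟨h1, h2⟩, _, h3⟩ => ⟨h1, h2, h3⟩⟩
end

section
/- Let G = (V,E) be a finite simple graph. Then in ℤ[β]: (1-β)^{|V|} · Σ_{s ⊆ E} (-β)^{|s|} · Π_{i ∈ V} (1 - deg_s(i)) = (1-β)^{|E|} · Σ_{s ⊆ E, every connected component of (V,s) has nullity at most 1} β^{|s|} · (1-β)^{t(s)} · 2^{u(s)}, where t(s) is the number of connected components of (V,s) of nullity 0 and u(s) is the number of connected components of nullity 1. -/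
open Polynomial

attribute [local instance] Classical.propDecidable

/-- Number of edges of `s` lying in the connected component `K` of `(V, s)`. -/
noncomputable def compEdges {V : Type*} (s : Finset (Sym2 V))
    (K : (subSpan s).ConnectedComponent) : ℕ :=
  (s.filter (fun e => ∀ v ∈ e, (subSpan s).connectedComponentMk v = K)).card

/-- Number of vertices in the connected component `K` of `(V, s)`. -/
noncomputable def compVerts {V : Type*} (s : Finset (Sym2 V))
    (K : (subSpan s).ConnectedComponent) : ℕ :=
  Nat.card {v : V // (subSpan s).connectedComponentMk v = K}

/-- Nullity (#edges − #vertices + 1) of the connected component `K` of `(V, s)`. -/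
noncomputable def compNullity {V : Type*} (s : Finset (Sym2 V))
    (K : (subSpan s).ConnectedComponent) : ℕ :=
  compEdges s K + 1 - compVerts s K

section SubsetSums

/-- Binomial inversion over the subsets of a finite set. -/
theorem sum_powerset_neg_pow_card_mul {α R : Type*} [CommRing R] (E : Finset α) (x y : R)
    (hxy : x + y = 1) (g : Finset α → R) :
    ∑ s ∈ E.powerset, (-x) ^ s.card * g s =
      ∑ s ∈ E.powerset, x ^ s.card * y ^ (E.card - s.card) *
        ∑ r ∈ s.powerset, (-1) ^ r.card * g r := by
  induction E using Finset.induction_on generalizing g with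
  | empty => simp
  | insert a E ha ih =>
    have hsub : ∀ s ∈ E.powerset, a ∉ s ∧ s.card ≤ E.card := fun s hs =>
      ⟨fun h => ha (Finset.mem_powerset.1 hs h), Finset.card_le_card (Finset.mem_powerset.1 hs)⟩
    have h1 : ∑ s ∈ E.powerset, (-x) ^ (insert a s).card * g (insert a s) =
        -x * ∑ s ∈ E.powerset, (-x) ^ s.card * g (insert a s) := by
      rw [Finset.mul_sum]
      refine Finset.sum_congr rfl fun s hs => ?_
      rw [Finset.card_insert_of_notMem (hsub s hs).1]
      ring
    rw [Finset.sum_powerset_insert ha, Finset.sum_powerset_insert ha, h1, ih g,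
      ih (fun s => g (insert a s)), Finset.mul_sum, ← Finset.sum_add_distrib,
      ← Finset.sum_add_distrib]
    refine Finset.sum_congr rfl fun s hs => ?_
    obtain ⟨has, hc⟩ := hsub s hs
    have h2 : ∑ r ∈ s.powerset, (-1 : R) ^ (insert a r).card * g (insert a r) =
        -∑ r ∈ s.powerset, (-1) ^ r.card * g (insert a r) := by
      rw [← Finset.sum_neg_distrib]
      refine Finset.sum_congr rfl fun r hr => ?_
      rw [Finset.card_insert_of_notMem fun h => has (Finset.mem_powerset.1 hr h)]
      ring
    rw [Finset.sum_powerset_insert has, h2, Finset.card_insert_of_notMem ha,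
      Finset.card_insert_of_notMem has, Nat.succ_sub hc, Nat.add_sub_add_right, Nat.succ_eq_add_one]
    obtain rfl : y = 1 - x := by rw [← hxy]; ring
    ring

/-- The alternating sum over the subsets of `s` containing a smaller set `T` vanishes. -/
theorem sum_powerset_filter_subset_neg_one_pow_card {α : Type*} {s T : Finset α}
    (hlt : T.card < s.card) :
    ∑ r ∈ s.powerset.filter (T ⊆ ·), (-1 : ℤ) ^ r.card = 0 := by
  obtain ⟨e, hes, heT⟩ := Finset.exists_mem_notMem_of_card_lt_card hlt
  have he : e ∉ s.erase e := Finset.notMem_erase e s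
  rw [Finset.sum_filter, ← Finset.insert_erase hes, Finset.sum_powerset_insert he,
    ← Finset.sum_add_distrib]
  refine Finset.sum_eq_zero fun r hr => ?_
  have her : e ∉ r := fun h => he (Finset.mem_powerset.1 hr h)
  simp only [Finset.card_insert_of_notMem her, Finset.subset_insert_iff_of_notMem heT]
  split_ifs <;> ring

end SubsetSums

/-- The alternating subset sum, equal to the theta polynomial of `(V, s)` at `β = 1`. -/
noncomputable def altSum {V : Type*} [Fintype V] (s : Finset (Sym2 V)) : ℤ :=
  ∑ r ∈ s.powerset, (-1) ^ r.card * ∏ i : V, (1 - (degIn r i : ℤ))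

section AltSum

variable {V : Type*}

theorem degIn_eq_sum {r s : Finset (Sym2 V)} (h : r ⊆ s) (i : V) :
    (degIn r i : ℤ) = ∑ e ∈ s.filter (i ∈ ·), if e ∈ r then 1 else 0 := by
  rw [degIn, Finset.sum_boole]
  congr 2
  ext e
  simp only [Finset.mem_filter]
  exact ⟨fun he => ⟨⟨h he.1, he.2⟩, he.1⟩, fun he => ⟨he.2, he.1.2⟩⟩

theorem degIn_le {r s : Finset (Sym2 V)} (h : r ⊆ s) (i : V) : degIn r i ≤ degIn s i :=
  Finset.card_le_card (Finset.filter_subset_filter _ h)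

theorem degIn_eq_zero_iff {s : Finset (Sym2 V)} {i : V} :
    degIn s i = 0 ↔ ∀ e ∈ s, i ∉ e := by
  rw [degIn, Finset.card_eq_zero, Finset.filter_eq_empty_iff]

theorem mem_of_degIn_eq {r s : Finset (Sym2 V)} (hr : r ⊆ s) {i : V}
    (h : degIn r i = degIn s i) {e : Sym2 V} (he : e ∈ s) (hi : i ∈ e) : e ∈ r := by
  have := Finset.eq_of_subset_of_card_le (Finset.filter_subset_filter (i ∈ ·) hr) h.ge
  have hm : e ∈ r.filter (i ∈ ·) := by rw [this]; simp [he, hi]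
  exact (Finset.mem_filter.1 hm).1

theorem sum_filter_subset_prod_eq_zero (s : Finset (Sym2 V)) (A : Finset V) :
    ∀ T ⊆ s, A.card + T.card < s.card →
      ∑ r ∈ s.powerset.filter (T ⊆ ·), (-1) ^ r.card * ∏ i ∈ A, (1 - (degIn r i : ℤ)) = 0 := by
  induction A using Finset.induction_on with
  | empty =>
    intro T hT hc
    simp only [Finset.prod_empty, mul_one]
    convert sum_powerset_filter_subset_neg_one_pow_card (T := T) (by simpa using hc)
  | insert i A hi ih =>
    intro T hT hc
    rw [Finset.card_insert_of_notMem hi] at hc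
    have key : ∀ r ∈ s.powerset.filter (T ⊆ ·),
        (-1) ^ r.card * ∏ j ∈ insert i A, (1 - (degIn r j : ℤ)) =
          (-1) ^ r.card * ∏ j ∈ A, (1 - (degIn r j : ℤ)) -
            ∑ e ∈ s.filter (i ∈ ·),
              if e ∈ r then (-1) ^ r.card * ∏ j ∈ A, (1 - (degIn r j : ℤ)) else 0 := by
      intro r hr
      rw [Finset.mem_filter, Finset.mem_powerset] at hr
      rw [Finset.prod_insert hi, degIn_eq_sum hr.1 i, sub_mul, one_mul, mul_sub, mul_left_comm,
        Finset.sum_mul]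
      simp only [ite_mul, one_mul, zero_mul]
    rw [Finset.sum_congr rfl key, Finset.sum_sub_distrib, ih T hT (by omega), Finset.sum_comm,
      zero_sub, neg_eq_zero]
    refine Finset.sum_eq_zero fun e he => ?_
    rw [Finset.mem_filter] at he
    have hc' := Finset.card_insert_le e T
    refine Eq.trans ?_ (ih (insert e T) (Finset.insert_subset he.1 hT) (by omega))
    rw [← Finset.sum_filter, Finset.filter_filter]
    refine Finset.sum_congr ?_ fun _ _ => rfl
    ext r
    simp only [Finset.mem_filter, Finset.insert_subset_iff]
    tauto

variable [Fintype V]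

/-- `altSum` vanishes when there are more edges than non-isolated vertices. -/
theorem altSum_eq_zero {s : Finset (Sym2 V)}
    (h : (Finset.univ.filter fun i => degIn s i ≠ 0).card < s.card) : altSum s = 0 := by
  rw [← sum_filter_subset_prod_eq_zero s _ ∅ (Finset.empty_subset s) (by simpa using h), altSum]
  refine Finset.sum_congr (by simp) fun r hr => ?_
  congr 1
  symm
  refine Finset.prod_subset (Finset.subset_univ _) fun i _ hi => ?_
  have h0 : degIn s i = 0 := by simpa using hi
  have := degIn_le (Finset.mem_powerset.1 (Finset.mem_filter.1 hr).1) i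
  simp [show degIn r i = 0 by omega]

/-- Deleting a pendant edge does not change `altSum`. -/
theorem altSum_erase {s : Finset (Sym2 V)} {e : Sym2 V} {v : V} (hes : e ∈ s) (hve : v ∈ e)
    (hv : ∀ f ∈ s, v ∈ f → f = e) : altSum (s.erase e) = altSum s := by
  have he : e ∉ s.erase e := Finset.notMem_erase e s
  conv_rhs => rw [← Finset.insert_erase hes]
  rw [altSum, altSum, Finset.sum_powerset_insert he, left_eq_add]
  refine Finset.sum_eq_zero fun r hr => ?_
  have hd : degIn (insert e r) v = 1 := by
    rw [degIn, Finset.card_eq_one]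
    refine ⟨e, ?_⟩
    ext f
    simp only [Finset.mem_filter, Finset.mem_insert, Finset.mem_singleton]
    refine ⟨?_, fun h => by subst h; exact ⟨Or.inl rfl, hve⟩⟩
    rintro ⟨rfl | hf, hvf⟩
    · rfl
    · exact hv f (Finset.mem_of_mem_erase (Finset.mem_powerset.1 hr hf)) hvf
  rw [Finset.prod_eq_zero (Finset.mem_univ v) (by simp [hd]), mul_zero]

end AltSum

/-- The edges of `s` lying in the connected component `K` of `(V, s)`. -/
noncomputable def componentEdges {V : Type*} (s : Finset (Sym2 V))
    (K : (subSpan s).ConnectedComponent) : Finset (Sym2 V) :=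
  s.filter fun e => ∀ v ∈ e, (subSpan s).connectedComponentMk v = K

section Components

variable {V : Type*} {s : Finset (Sym2 V)}

theorem subSpan_adj {a b : V} : (subSpan s).Adj a b ↔ s(a, b) ∈ s ∧ a ≠ b := by
  simp [subSpan]

theorem connectedComponentMk_eq_of_mem {e : Sym2 V} (he : e ∈ s) {a b : V} (ha : a ∈ e)
    (hb : b ∈ e) : (subSpan s).connectedComponentMk a = (subSpan s).connectedComponentMk b := by
  by_cases hab : a = b
  · rw [hab]
  · rw [(Sym2.mem_and_mem_iff hab).1 ⟨ha, hb⟩] at he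
    exact SimpleGraph.ConnectedComponent.sound (subSpan_adj.2 ⟨he, hab⟩).reachable

theorem forall_mem_connectedComponentMk_eq_iff {e : Sym2 V} (he : e ∈ s) {a : V} (ha : a ∈ e)
    {K : (subSpan s).ConnectedComponent} :
    (∀ v ∈ e, (subSpan s).connectedComponentMk v = K) ↔
      (subSpan s).connectedComponentMk a = K :=
  ⟨fun h => h a ha, fun h _ hv => (connectedComponentMk_eq_of_mem he hv ha).trans h⟩

theorem card_componentEdges (K : (subSpan s).ConnectedComponent) :
    (componentEdges s K).card = compEdges s K := rfl

theorem mem_componentEdges {e : Sym2 V} {K : (subSpan s).ConnectedComponent} :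
    e ∈ componentEdges s K ↔ e ∈ s ∧ ∀ v ∈ e, (subSpan s).connectedComponentMk v = K := by
  rw [componentEdges, Finset.mem_filter]

/-- A function constant along the edges of `s` is constant on connected components. -/
theorem eq_of_connectedComponentMk_eq {β : Type*} {p : V → β}
    (hp : ∀ a b, s(a, b) ∈ s → p a = p b) {a b : V}
    (h : (subSpan s).connectedComponentMk a = (subSpan s).connectedComponentMk b) :
    p a = p b := by
  obtain ⟨w⟩ := SimpleGraph.ConnectedComponent.exact h
  induction w with
  | nil => rfl
  | cons hadj _ ih =>
    exact (hp _ _ (subSpan_adj.1 hadj).1).trans (ih (SimpleGraph.ConnectedComponent.sound ⟨‹_›⟩))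

theorem connectedComponentMk_eq_iff_of_degIn_eq_zero {v a : V} (hv : degIn s v = 0) :
    (subSpan s).connectedComponentMk a = (subSpan s).connectedComponentMk v ↔ a = v := by
  refine ⟨fun h => ?_, fun h => by rw [h]⟩
  rw [degIn_eq_zero_iff] at hv
  have := eq_of_connectedComponentMk_eq (p := fun x => x = v) (fun a b hab => by
    have h1 : a ≠ v := fun h => hv _ hab (by simp [h])
    have h2 : b ≠ v := fun h => hv _ hab (by simp [h])
    simp [h1, h2]) h
  simpa using this

theorem compEdges_of_degIn_eq_zero {v : V} (hv : degIn s v = 0) :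
    compEdges s ((subSpan s).connectedComponentMk v) = 0 := by
  rw [compEdges, Finset.card_eq_zero, Finset.filter_eq_empty_iff]
  intro e he h
  induction e with | _ a b
  have := (connectedComponentMk_eq_iff_of_degIn_eq_zero hv).1 (h a (by simp))
  exact degIn_eq_zero_iff.1 hv _ he (by simp [this])

theorem compVerts_of_degIn_eq_zero {v : V} (hv : degIn s v = 0) :
    compVerts s ((subSpan s).connectedComponentMk v) = 1 := by
  simp only [compVerts, connectedComponentMk_eq_iff_of_degIn_eq_zero hv]
  simp

variable [Fintype V]

theorem compVerts_eq_card_filter (K : (subSpan s).ConnectedComponent) :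
    compVerts s K =
      (Finset.univ.filter fun v => (subSpan s).connectedComponentMk v = K).card := by
  rw [compVerts, Nat.card_eq_fintype_card, Fintype.card_subtype]

theorem card_filter_mem_of_not_isDiag {e : Sym2 V} (he : ¬ e.IsDiag) :
    (Finset.univ.filter (· ∈ e)).card = 2 := by
  induction e with | _ a b
  rw [Sym2.mk_isDiag_iff] at he
  rw [← Finset.card_pair he]
  congr 1
  ext x
  simp

/-- The handshake lemma. -/
theorem sum_degIn (hs : ∀ e ∈ s, ¬ e.IsDiag) : ∑ i : V, degIn s i = 2 * s.card := by
  have : ∑ i : V, degIn s i = ∑ e ∈ s, (Finset.univ.filter (· ∈ e)).card :=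
    Finset.sum_card_bipartiteAbove_eq_sum_card_bipartiteBelow _
  rw [this, Finset.sum_congr rfl fun e he => card_filter_mem_of_not_isDiag (hs e he)]
  simp [mul_comm]

/-- The handshake lemma within a connected component. -/
theorem sum_degIn_component (hs : ∀ e ∈ s, ¬ e.IsDiag) (K : (subSpan s).ConnectedComponent) :
    ∑ i with (subSpan s).connectedComponentMk i = K, degIn s i = 2 * compEdges s K := by
  rw [← card_componentEdges, ← sum_degIn fun e he => hs e (mem_componentEdges.1 he).1,
    Finset.sum_filter]
  refine Finset.sum_congr rfl fun i _ => ?_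
  split_ifs with h
  · rw [degIn, degIn]
    congr 1
    ext e
    rw [Finset.mem_filter, Finset.mem_filter, mem_componentEdges]
    exact ⟨fun ⟨he, hi⟩ => ⟨⟨he, (forall_mem_connectedComponentMk_eq_iff he hi).2 h⟩, hi⟩,
      fun ⟨he, hi⟩ => ⟨he.1, hi⟩⟩
  · symm
    rw [degIn_eq_zero_iff]
    exact fun e he hi => h ((mem_componentEdges.1 he).2 i hi)

theorem sum_compVerts : ∑ K, compVerts s K = Fintype.card V := by
  simp only [compVerts_eq_card_filter]
  exact (Finset.card_eq_sum_card_fiberwise fun _ _ => Finset.mem_coe.2 (Finset.mem_univ _)).symm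

theorem sum_compEdges : ∑ K, compEdges s K = s.card := by
  have : ∀ K, compEdges s K =
      (s.filter fun e => (subSpan s).connectedComponentMk (Quot.out e).1 = K).card := by
    intro K
    rw [← card_componentEdges]
    congr 1
    ext e
    rw [mem_componentEdges, Finset.mem_filter]
    exact and_congr_right fun he =>
      forall_mem_connectedComponentMk_eq_iff he (Sym2.out_fst_mem e)
  simp only [this]
  exact (Finset.card_eq_sum_card_fiberwise fun _ _ => Finset.mem_coe.2 (Finset.mem_univ _)).symm

end Components

section Pendant

variable {V : Type*} {s : Finset (Sym2 V)} {v w : V}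

theorem degIn_erase_eq_zero (hv : ∀ f ∈ s, v ∈ f → f = s(v, w)) :
    degIn (s.erase s(v, w)) v = 0 :=
  degIn_eq_zero_iff.2 fun f hf hvf =>
    Finset.ne_of_mem_erase hf (hv f (Finset.mem_of_mem_erase hf) hvf)

theorem connectedComponentMk_eq_of_erase {e : Sym2 V} {a b : V}
    (h : (subSpan (s.erase e)).connectedComponentMk a =
      (subSpan (s.erase e)).connectedComponentMk b) :
    (subSpan s).connectedComponentMk a = (subSpan s).connectedComponentMk b :=
  eq_of_connectedComponentMk_eq (p := (subSpan s).connectedComponentMk) (fun _ _ hab =>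
    connectedComponentMk_eq_of_mem (Finset.mem_of_mem_erase hab) (Sym2.mem_mk_left _ _)
      (Sym2.mem_mk_right _ _)) h

theorem connectedComponentMk_erase_of_eq (hw : w ≠ v)
    (hv : ∀ f ∈ s, v ∈ f → f = s(v, w)) {a b : V}
    (h : (subSpan s).connectedComponentMk a = (subSpan s).connectedComponentMk b) :
    (subSpan (s.erase s(v, w))).connectedComponentMk (if a = v then w else a) =
      (subSpan (s.erase s(v, w))).connectedComponentMk (if b = v then w else b) := by
  refine eq_of_connectedComponentMk_eq (p := fun x =>
    (subSpan (s.erase s(v, w))).connectedComponentMk (if x = v then w else x)) ?_ h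
  intro a b hab
  by_cases he : s(a, b) = s(v, w)
  · rcases Sym2.eq_iff.1 he with ⟨rfl, rfl⟩ | ⟨rfl, rfl⟩ <;> simp [hw]
  · have ha : a ≠ v := fun h => he (hv _ hab (by simp [h]))
    have hb : b ≠ v := fun h => he (hv _ hab (by simp [h]))
    rw [if_neg ha, if_neg hb]
    exact connectedComponentMk_eq_of_mem (Finset.mem_erase.2 ⟨he, hab⟩) (Sym2.mem_mk_left _ _)
      (Sym2.mem_mk_right _ _)

theorem connectedComponentMk_erase_iff (hw : w ≠ v)
    (hv : ∀ f ∈ s, v ∈ f → f = s(v, w)) {a b : V} (ha : a ≠ v) (hb : b ≠ v) :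
    (subSpan (s.erase s(v, w))).connectedComponentMk a =
      (subSpan (s.erase s(v, w))).connectedComponentMk b ↔
    (subSpan s).connectedComponentMk a = (subSpan s).connectedComponentMk b := by
  refine ⟨connectedComponentMk_eq_of_erase, fun h => ?_⟩
  simpa [ha, hb] using connectedComponentMk_erase_of_eq hw hv h

theorem compEdges_erase (hw : w ≠ v) (hvs : s(v, w) ∈ s)
    (hv : ∀ f ∈ s, v ∈ f → f = s(v, w)) {a : V} (ha : a ≠ v) :
    compEdges s ((subSpan s).connectedComponentMk a) =
      compEdges (s.erase s(v, w)) ((subSpan (s.erase s(v, w))).connectedComponentMk a) +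
        if (subSpan s).connectedComponentMk w = (subSpan s).connectedComponentMk a
          then 1 else 0 := by
  simp only [compEdges, Finset.card_filter]
  rw [← Finset.add_sum_erase _ _ hvs, add_comm,
    forall_mem_connectedComponentMk_eq_iff hvs (Sym2.mem_mk_right v w)]
  congr 1
  refine Finset.sum_congr rfl fun f hf => ?_
  congr 1
  refine propext (forall₂_congr fun x hx => ?_)
  have hxv : x ≠ v := by
    rintro rfl
    exact Finset.ne_of_mem_erase hf (hv f (Finset.mem_of_mem_erase hf) hx)
  rw [connectedComponentMk_erase_iff hw hv hxv ha]

theorem compNullity_of_degIn_eq_zero {t : Finset (Sym2 V)} (h : degIn t v = 0) :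
    compNullity t ((subSpan t).connectedComponentMk v) = 0 := by
  rw [compNullity, compEdges_of_degIn_eq_zero h, compVerts_of_degIn_eq_zero h]

/-- Every component of `(V, s)` meets the complement of a pendant vertex. -/
theorem exists_ne_connectedComponentMk (hw : w ≠ v) (hvs : s(v, w) ∈ s)
    (K : (subSpan s).ConnectedComponent) :
    ∃ a, a ≠ v ∧ (subSpan s).connectedComponentMk a = K := by
  induction K using SimpleGraph.ConnectedComponent.ind with | _ a
  by_cases ha : a = v
  · subst ha
    exact ⟨w, hw,
      connectedComponentMk_eq_of_mem hvs (Sym2.mem_mk_right _ _) (Sym2.mem_mk_left _ _)⟩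
  · exact ⟨a, ha, rfl⟩

variable [Fintype V]

theorem compVerts_erase (hw : w ≠ v) (hvs : s(v, w) ∈ s)
    (hv : ∀ f ∈ s, v ∈ f → f = s(v, w)) {a : V} (ha : a ≠ v) :
    compVerts s ((subSpan s).connectedComponentMk a) =
      compVerts (s.erase s(v, w)) ((subSpan (s.erase s(v, w))).connectedComponentMk a) +
        if (subSpan s).connectedComponentMk w = (subSpan s).connectedComponentMk a
          then 1 else 0 := by
  have hvw : (subSpan s).connectedComponentMk v = (subSpan s).connectedComponentMk w :=
    connectedComponentMk_eq_of_mem hvs (Sym2.mem_mk_left _ _) (Sym2.mem_mk_right _ _)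
  have hva : (subSpan (s.erase s(v, w))).connectedComponentMk v ≠
      (subSpan (s.erase s(v, w))).connectedComponentMk a := fun h =>
    ha ((connectedComponentMk_eq_iff_of_degIn_eq_zero (degIn_erase_eq_zero hv)).1 h.symm)
  simp only [compVerts_eq_card_filter, Finset.card_filter]
  rw [← Finset.add_sum_erase _ _ (Finset.mem_univ v), ← Finset.add_sum_erase _ _
    (Finset.mem_univ v), if_neg hva, hvw, zero_add, add_comm]
  congr 1
  refine Finset.sum_congr rfl fun x hx => ?_
  rw [connectedComponentMk_erase_iff hw hv (Finset.ne_of_mem_erase hx) ha]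

theorem compNullity_erase (hw : w ≠ v) (hvs : s(v, w) ∈ s)
    (hv : ∀ f ∈ s, v ∈ f → f = s(v, w)) {a : V} (ha : a ≠ v) :
    compNullity s ((subSpan s).connectedComponentMk a) =
      compNullity (s.erase s(v, w)) ((subSpan (s.erase s(v, w))).connectedComponentMk a) := by
  rw [compNullity, compNullity, compVerts_erase hw hvs hv ha, compEdges_erase hw hvs hv ha]
  omega

theorem forall_compNullity_le_one_erase_iff (hw : w ≠ v) (hvs : s(v, w) ∈ s)
    (hv : ∀ f ∈ s, v ∈ f → f = s(v, w)) :
    (∀ K, compNullity (s.erase s(v, w)) K ≤ 1) ↔ ∀ K, compNullity s K ≤ 1 := by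
  constructor
  · intro h K
    obtain ⟨a, ha, rfl⟩ := exists_ne_connectedComponentMk hw hvs K
    rw [compNullity_erase hw hvs hv ha]
    exact h _
  · intro h K
    induction K using SimpleGraph.ConnectedComponent.ind with | _ a
    by_cases ha : a = v
    · rw [ha, compNullity_of_degIn_eq_zero (degIn_erase_eq_zero hv)]
      exact zero_le_one
    · rw [← compNullity_erase hw hvs hv ha]
      exact h _

theorem card_compNullity_eq_one_erase (hw : w ≠ v) (hvs : s(v, w) ∈ s)
    (hv : ∀ f ∈ s, v ∈ f → f = s(v, w)) :
    Nat.card {K // compNullity (s.erase s(v, w)) K = 1} =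
      Nat.card {K // compNullity s K = 1} := by
  have hne : ∀ a, compNullity (s.erase s(v, w))
      ((subSpan (s.erase s(v, w))).connectedComponentMk a) = 1 → a ≠ v := by
    rintro a h rfl
    rw [compNullity_of_degIn_eq_zero (degIn_erase_eq_zero hv)] at h
    exact zero_ne_one h
  let φ : (subSpan (s.erase s(v, w))).ConnectedComponent → (subSpan s).ConnectedComponent :=
    fun K => K.map (SimpleGraph.Hom.ofLE (SimpleGraph.fromEdgeSet_mono
      (Finset.coe_subset.2 (Finset.erase_subset _ _))))
  have hφ : ∀ a, φ ((subSpan (s.erase s(v, w))).connectedComponentMk a) =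
      (subSpan s).connectedComponentMk a := fun a => rfl
  have hmap : ∀ K, compNullity (s.erase s(v, w)) K = 1 → compNullity s (φ K) = 1 := by
    intro K hK
    induction K using SimpleGraph.ConnectedComponent.ind with | _ a
    rw [hφ, compNullity_erase hw hvs hv (hne a hK), hK]
  refine Nat.card_eq_of_bijective (fun K => ⟨φ K.1, hmap K.1 K.2⟩) ⟨?_, ?_⟩
  · rintro ⟨K, hK⟩ ⟨L, hL⟩ h
    induction K using SimpleGraph.ConnectedComponent.ind with | _ a
    induction L using SimpleGraph.ConnectedComponent.ind with | _ b
    rw [Subtype.mk.injEq] at h ⊢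
    exact (connectedComponentMk_erase_iff hw hv (hne a hK) (hne b hL)).2 h
  · rintro ⟨K, hK⟩
    obtain ⟨a, ha, rfl⟩ := exists_ne_connectedComponentMk hw hvs K
    rw [compNullity_erase hw hvs hv ha] at hK
    exact ⟨⟨_, hK⟩, rfl⟩

end Pendant

section NoLeaves

variable {V : Type*} [Fintype V] {s : Finset (Sym2 V)}

/-- A component of a graph without leaves is an isolated vertex, or all its degrees are at
least two. -/
theorem component_cases_of_degIn_ne_one (hl : ∀ i, degIn s i ≠ 1)
    (K : (subSpan s).ConnectedComponent) :
    (compEdges s K = 0 ∧ compVerts s K = 1) ∨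
      ∀ i, (subSpan s).connectedComponentMk i = K → 2 ≤ degIn s i := by
  by_cases h : ∃ i, (subSpan s).connectedComponentMk i = K ∧ degIn s i = 0
  · obtain ⟨i, rfl, hi⟩ := h
    exact Or.inl ⟨compEdges_of_degIn_eq_zero hi, compVerts_of_degIn_eq_zero hi⟩
  · right
    intro i hi
    have h0 : degIn s i ≠ 0 := fun h0 => h ⟨i, hi, h0⟩
    have := hl i
    omega

theorem compVerts_le_compEdges (hs : ∀ e ∈ s, ¬ e.IsDiag)
    {K : (subSpan s).ConnectedComponent}
    (hK : ∀ i, (subSpan s).connectedComponentMk i = K → 2 ≤ degIn s i) :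
    compVerts s K ≤ compEdges s K := by
  have h := Finset.card_nsmul_le_sum
    (Finset.univ.filter fun i => (subSpan s).connectedComponentMk i = K) (degIn s) 2
    fun i hi => hK i (Finset.mem_filter.1 hi).2
  rw [sum_degIn_component hs, ← compVerts_eq_card_filter, smul_eq_mul] at h
  omega

theorem compVerts_le_compEdges_add_one_of_degIn_ne_one (hs : ∀ e ∈ s, ¬ e.IsDiag)
    (hl : ∀ i, degIn s i ≠ 1) (K : (subSpan s).ConnectedComponent) :
    compVerts s K ≤ compEdges s K + 1 := by
  rcases component_cases_of_degIn_ne_one hl K with h | h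
  · omega
  · have := compVerts_le_compEdges hs h
    omega

theorem altSum_eq_zero_of_three_le_degIn (hs : ∀ e ∈ s, ¬ e.IsDiag)
    (hl : ∀ i, degIn s i ≠ 1) {i : V} (hi : 3 ≤ degIn s i) : altSum s = 0 := by
  apply altSum_eq_zero
  have h : ∑ j with degIn s j ≠ 0, 2 < ∑ j with degIn s j ≠ 0, degIn s j := by
    refine Finset.sum_lt_sum (fun j hj => ?_) ⟨i, ?_, by omega⟩
    · have := (Finset.mem_filter.1 hj).2
      have := hl j
      omega
    · simp only [Finset.mem_filter, Finset.mem_univ, true_and]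
      omega
  rw [Finset.sum_filter_ne_zero, sum_degIn hs, Finset.sum_const, smul_eq_mul] at h
  omega

theorem two_le_compNullity_of_three_le_degIn (hs : ∀ e ∈ s, ¬ e.IsDiag)
    (hl : ∀ i, degIn s i ≠ 1) {i : V} (hi : 3 ≤ degIn s i) :
    2 ≤ compNullity s ((subSpan s).connectedComponentMk i) := by
  rcases component_cases_of_degIn_ne_one hl ((subSpan s).connectedComponentMk i) with h | h
  · have h1 := sum_degIn_component hs ((subSpan s).connectedComponentMk i)
    rw [h.1, mul_zero, Finset.sum_eq_zero_iff] at h1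
    have := h1 i (by simp)
    omega
  · have hlt : ∑ j with (subSpan s).connectedComponentMk j =
        (subSpan s).connectedComponentMk i, 2 <
        ∑ j with (subSpan s).connectedComponentMk j =
          (subSpan s).connectedComponentMk i, degIn s j :=
      Finset.sum_lt_sum (fun j hj => h j (Finset.mem_filter.1 hj).2) ⟨i, by simp, by omega⟩
    rw [sum_degIn_component hs, Finset.sum_const, ← compVerts_eq_card_filter, smul_eq_mul] at hlt
    rw [compNullity]
    omega

theorem compNullity_of_degIn_eq_two (hs : ∀ e ∈ s, ¬ e.IsDiag)
    (hd : ∀ i, degIn s i = 0 ∨ degIn s i = 2) (i : V) :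
    compNullity s ((subSpan s).connectedComponentMk i) = if degIn s i = 0 then 0 else 1 := by
  split_ifs with h0
  · exact compNullity_of_degIn_eq_zero h0
  · have hK : ∀ j, (subSpan s).connectedComponentMk j = (subSpan s).connectedComponentMk i →
        degIn s j = 2 := by
      intro j hj
      refine (hd j).resolve_left fun hj0 => h0 ?_
      rwa [(connectedComponentMk_eq_iff_of_degIn_eq_zero hj0).1 hj.symm]
    have h := sum_degIn_component hs ((subSpan s).connectedComponentMk i)
    rw [Finset.sum_congr rfl fun j hj => hK j (Finset.mem_filter.1 hj).2, Finset.sum_const,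
      ← compVerts_eq_card_filter, smul_eq_mul] at h
    rw [compNullity]
    omega

/-- The contribution of `r` to the alternating sum of a disjoint union of cycles is `1` if `r`
is a union of cycles, and `0` otherwise. -/
theorem neg_one_pow_mul_prod_eq_ite (hs : ∀ e ∈ s, ¬ e.IsDiag)
    (hd : ∀ i, degIn s i = 0 ∨ degIn s i = 2) {r : Finset (Sym2 V)} (hr : r ⊆ s) :
    (-1) ^ r.card * ∏ i : V, (1 - (degIn r i : ℤ)) =
      if ∀ i, degIn r i = 0 ∨ degIn r i = 2 then 1 else 0 := by
  split_ifs with h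
  · have h1 : ∀ i, (1 - (degIn r i : ℤ)) = (-1) ^ (degIn r i / 2) := by
      intro i
      rcases h i with h | h <;> norm_num [h]
    have h2 : ∑ i, degIn r i / 2 = r.card := by
      have h3 := sum_degIn fun e he => hs e (hr he)
      rw [← Finset.sum_congr rfl fun i _ =>
        Nat.mul_div_cancel' (show 2 ∣ degIn r i by rcases h i with h | h <;> simp [h]),
        ← Finset.mul_sum] at h3
      omega
    rw [Finset.prod_congr rfl fun i _ => h1 i, Finset.prod_pow_eq_pow_sum, h2, ← mul_pow]
    simp
  · push Not at h
    obtain ⟨i, h0, h2⟩ := h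
    have := degIn_le hr i
    have := hd i
    rw [Finset.prod_eq_zero (Finset.mem_univ i), mul_zero]
    rw [show degIn r i = 1 by omega]
    simp

theorem card_unions_of_cycles (hs : ∀ e ∈ s, ¬ e.IsDiag)
    (hd : ∀ i, degIn s i = 0 ∨ degIn s i = 2) :
    (s.powerset.filter fun r => ∀ i, degIn r i = 0 ∨ degIn r i = 2).card =
      2 ^ Nat.card {K // compNullity s K = 1} := by
  rw [Nat.card_eq_fintype_card, Fintype.card_subtype, ← Finset.card_powerset]
  symm
  have hnul := compNullity_of_degIn_eq_two hs hd
  have hpos : ∀ {e : Sym2 V} {i : V}, e ∈ s → i ∈ e →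
      compNullity s ((subSpan s).connectedComponentMk i) = 1 := by
    intro e i he hi
    rw [hnul, if_neg fun h => degIn_eq_zero_iff.1 h e he hi]
  refine Finset.card_nbij (fun S => s.filter fun e =>
    ∃ K ∈ S, ∀ v ∈ e, (subSpan s).connectedComponentMk v = K) ?_ ?_ ?_
  · intro S hS
    refine Finset.mem_coe.2 (Finset.mem_filter.2
      ⟨Finset.mem_powerset.2 (Finset.filter_subset _ _), fun i => ?_⟩)
    by_cases hi : (subSpan s).connectedComponentMk i ∈ S
    · convert hd i using 2 <;>
      · rw [degIn, degIn, Finset.filter_filter]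
        refine congrArg Finset.card (Finset.filter_congr fun e he => ?_)
        exact ⟨fun h => h.2, fun h =>
          ⟨⟨_, hi, (forall_mem_connectedComponentMk_eq_iff he h).2 rfl⟩, h⟩⟩
    · left
      rw [degIn_eq_zero_iff]
      intro e he hie
      obtain ⟨K, hK, h⟩ := (Finset.mem_filter.1 he).2
      exact hi (by rwa [h i hie])
  · have key : ∀ S T : Finset (subSpan s).ConnectedComponent,
        S ∈ (Finset.univ.filter fun K => compNullity s K = 1).powerset →
        (s.filter fun e => ∃ K ∈ S, ∀ v ∈ e, (subSpan s).connectedComponentMk v = K) =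
          (s.filter fun e => ∃ K ∈ T, ∀ v ∈ e, (subSpan s).connectedComponentMk v = K) →
        S ⊆ T := by
      intro S T hS h K hK
      have hK1 : compNullity s K = 1 :=
        (Finset.mem_filter.1 (Finset.mem_powerset.1 hS hK)).2
      induction K using SimpleGraph.ConnectedComponent.ind with | _ i
      have h0 : degIn s i ≠ 0 := fun h0 => by
        rw [compNullity_of_degIn_eq_zero h0] at hK1
        exact zero_ne_one hK1
      rw [Ne, degIn_eq_zero_iff] at h0
      push Not at h0
      obtain ⟨e, he, hie⟩ := h0
      have hm : e ∈ s.filter fun e => ∃ K ∈ S, ∀ v ∈ e,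
          (subSpan s).connectedComponentMk v = K :=
        Finset.mem_filter.2
          ⟨he, _, hK, (forall_mem_connectedComponentMk_eq_iff he hie).2 rfl⟩
      rw [h] at hm
      obtain ⟨L, hL, hL'⟩ := (Finset.mem_filter.1 hm).2
      rwa [hL' i hie]
    intro S hS T hT h
    exact Finset.Subset.antisymm (key S T hS h) (key T S hT h.symm)
  · intro r hr
    rw [Finset.mem_coe, Finset.mem_filter, Finset.mem_powerset] at hr
    obtain ⟨hrs, hr⟩ := hr
    have hall : ∀ {i : V} {e f : Sym2 V}, e ∈ r → i ∈ e → f ∈ s → i ∈ f → f ∈ r := by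
      intro i e f he hie hf hif
      have h1 : degIn r i ≠ 0 := fun h => degIn_eq_zero_iff.1 h e he hie
      have := degIn_le hrs i
      have := hd i
      have := hr i
      exact mem_of_degIn_eq hrs (by omega) hf hif
    have hconst : ∀ a b, s(a, b) ∈ s → (∃ e ∈ r, a ∈ e) = (∃ e ∈ r, b ∈ e) := by
      intro a b hab
      refine propext ⟨?_, ?_⟩
      · rintro ⟨e, he, hae⟩
        exact ⟨_, hall he hae hab (Sym2.mem_mk_left _ _), Sym2.mem_mk_right _ _⟩
      · rintro ⟨e, he, hbe⟩
        exact ⟨_, hall he hbe hab (Sym2.mem_mk_right _ _), Sym2.mem_mk_left _ _⟩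
    refine ⟨Finset.univ.filter fun K =>
      ∃ i, (subSpan s).connectedComponentMk i = K ∧ ∃ e ∈ r, i ∈ e, ?_, ?_⟩
    · rw [Finset.mem_coe, Finset.mem_powerset]
      intro K hK
      obtain ⟨i, rfl, e, he, hie⟩ := (Finset.mem_filter.1 hK).2
      simpa using hpos (hrs he) hie
    · ext f
      simp only [Finset.mem_filter, Finset.mem_univ, true_and]
      constructor
      · rintro ⟨hf, K, ⟨i, rfl, hi⟩, h⟩
        have hmem := Sym2.out_fst_mem f
        have := eq_of_connectedComponentMk_eq (p := fun x => ∃ e ∈ r, x ∈ e) hconst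
          (h _ hmem).symm
        obtain ⟨e, he, hie⟩ := this ▸ hi
        exact hall he hie hf hmem
      · intro hf
        have hmem := Sym2.out_fst_mem f
        exact ⟨hrs hf, _, ⟨_, rfl, f, hf, hmem⟩,
          (forall_mem_connectedComponentMk_eq_iff (hrs hf) hmem).2 rfl⟩

end NoLeaves

section Evaluation

variable {V : Type*} [Fintype V]

theorem altSum_eq_of_degIn_ne_one {s : Finset (Sym2 V)} (hs : ∀ e ∈ s, ¬ e.IsDiag)
    (hl : ∀ i, degIn s i ≠ 1) :
    altSum s =
      if ∀ K, compNullity s K ≤ 1 then 2 ^ Nat.card {K // compNullity s K = 1} else 0 := by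
  by_cases h3 : ∃ i, 3 ≤ degIn s i
  · obtain ⟨i, hi⟩ := h3
    rw [altSum_eq_zero_of_three_le_degIn hs hl hi, if_neg]
    intro h
    have h1 := h ((subSpan s).connectedComponentMk i)
    have h2 := two_le_compNullity_of_three_le_degIn hs hl hi
    omega
  · push Not at h3
    have hd : ∀ i, degIn s i = 0 ∨ degIn s i = 2 := by
      intro i
      have := hl i
      have := h3 i
      omega
    rw [if_pos]
    · rw [altSum, Finset.sum_congr rfl fun r hr =>
        neg_one_pow_mul_prod_eq_ite hs hd (Finset.mem_powerset.1 hr), Finset.sum_boole,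
        card_unions_of_cycles hs hd]
      simp
    · intro K
      induction K using SimpleGraph.ConnectedComponent.ind with | _ i
      rw [compNullity_of_degIn_eq_two hs hd]
      split_ifs <;> simp

theorem compVerts_le_and_altSum_eq (s : Finset (Sym2 V)) (hs : ∀ e ∈ s, ¬ e.IsDiag) :
    (∀ K, compVerts s K ≤ compEdges s K + 1) ∧
      altSum s =
        if ∀ K, compNullity s K ≤ 1 then 2 ^ Nat.card {K // compNullity s K = 1} else 0 := by
  induction s using Finset.strongInduction with | _ s ih
  by_cases hl : ∀ i, degIn s i ≠ 1
  · exact ⟨compVerts_le_compEdges_add_one_of_degIn_ne_one hs hl,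
      altSum_eq_of_degIn_ne_one hs hl⟩
  · push Not at hl
    obtain ⟨v, hv1⟩ := hl
    obtain ⟨e, he⟩ := Finset.card_eq_one.1 hv1
    have hmem : ∀ f, f ∈ s ∧ v ∈ f ↔ f = e := fun f => by
      simpa using Finset.ext_iff.1 he f
    obtain ⟨hes, hve⟩ := (hmem e).2 rfl
    obtain ⟨w, rfl⟩ := hve
    have hw : w ≠ v := fun h => hs _ hes (by simp [h])
    have hv : ∀ f ∈ s, v ∈ f → f = s(v, w) := fun f hf hvf => (hmem f).1 ⟨hf, hvf⟩
    obtain ⟨ih1, ih2⟩ := ih _ (Finset.erase_ssubset hes)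
      fun f hf => hs f (Finset.mem_of_mem_erase hf)
    refine ⟨fun K => ?_, ?_⟩
    · obtain ⟨a, ha, rfl⟩ := exists_ne_connectedComponentMk hw hes K
      rw [compVerts_erase hw hes hv ha, compEdges_erase hw hes hv ha]
      have := ih1 ((subSpan (s.erase s(v, w))).connectedComponentMk a)
      omega
    · rw [← altSum_erase hes (Sym2.mem_mk_left v w) hv, ih2,
        card_compNullity_eq_one_erase hw hes hv]
      simp only [forall_compNullity_le_one_erase_iff hw hes hv]

/-- If all nullities are at most one, the number of tree components is `|V| - |s|`. -/
theorem card_add_card_compNullity_eq_zero {s : Finset (Sym2 V)} (hs : ∀ e ∈ s, ¬ e.IsDiag)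
    (h : ∀ K, compNullity s K ≤ 1) :
    s.card + Nat.card {K // compNullity s K = 0} = Fintype.card V := by
  rw [← sum_compVerts (s := s), ← sum_compEdges (s := s), Nat.card_eq_fintype_card,
    Fintype.card_subtype, Finset.card_filter, ← Finset.sum_add_distrib]
  refine Finset.sum_congr rfl fun K _ => ?_
  have h1 := h K
  have h2 := (compVerts_le_and_altSum_eq s hs).1 K
  rw [compNullity] at h1 ⊢
  split_ifs <;> omega

end Evaluation

theorem theta_2i_eq_omega {V : Type*} [Fintype V] [DecidableEq V]
    (G : SimpleGraph V) [DecidableRel G.Adj] :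
    (1 - X : Polynomial ℤ) ^ (Fintype.card V) *
        ∑ s ∈ G.edgeFinset.powerset,
          (-X : Polynomial ℤ) ^ s.card * ∏ i : V, (1 - (degIn s i : Polynomial ℤ))
      = (1 - X : Polynomial ℤ) ^ (G.edgeFinset.card) *
          ∑ s ∈ G.edgeFinset.powerset.filter
              (fun s => ∀ K : (subSpan s).ConnectedComponent, compNullity s K ≤ 1),
            X ^ s.card *
              (1 - X) ^ (Nat.card {K : (subSpan s).ConnectedComponent // compNullity s K = 0}) *
              2 ^ (Nat.card {K : (subSpan s).ConnectedComponent // compNullity s K = 1}) := by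
  have hdiag : ∀ s ∈ G.edgeFinset.powerset, ∀ e ∈ s, ¬ e.IsDiag := fun s hs e he =>
    G.not_isDiag_of_mem_edgeFinset (Finset.mem_powerset.1 hs he)
  rw [sum_powerset_neg_pow_card_mul G.edgeFinset X (1 - X) (by ring), Finset.sum_filter,
    Finset.mul_sum, Finset.mul_sum]
  refine Finset.sum_congr rfl fun s hs => ?_
  have hW : ∑ r ∈ s.powerset, (-1 : Polynomial ℤ) ^ r.card *
      ∏ i : V, (1 - (degIn r i : Polynomial ℤ)) = (altSum s : Polynomial ℤ) := by
    simp [altSum]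
  rw [hW, (compVerts_le_and_altSum_eq s (hdiag s hs)).2]
  by_cases h : ∀ K, compNullity s K ≤ 1
  · rw [if_pos h, if_pos h]
    have hc := Finset.card_le_card (Finset.mem_powerset.1 hs)
    have hpow : (1 - X : Polynomial ℤ) ^ (Fintype.card V) *
        (1 - X) ^ (G.edgeFinset.card - s.card) =
          (1 - X) ^ G.edgeFinset.card * (1 - X) ^ Nat.card {K // compNullity s K = 0} := by
      rw [← pow_add, ← pow_add]
      congr 1
      have := card_add_card_compNullity_eq_zero (hdiag s hs) h
      omega
    push_cast
    linear_combination (X ^ s.card * 2 ^ Nat.card {K // compNullity s K = 1}) * hpow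
  · rw [if_neg h, if_neg h]
    simp
end

section
/- Let G = (V,E) be a finite simple graph in which every connected component contains at least one cycle (i.e., no component has nullity 0). If P ∈ ℤ[β] satisfies (1-β)^{|V|} · Σ_{s ⊆ E} (-β)^{|s|} · Π_{i ∈ V} (1 - deg_s(i)) = (1-β)^{|E|} · P(β), then every coefficient of P is non-negative. -/
open Polynomial

attribute [local instance] Classical.propDecidable

/-- A polynomial with integer coefficients all of which are non-negative. -/
def NonnegCoeffs (p : ℤ[X]) : Prop := ∀ j, 0 ≤ p.coeff j

namespace NonnegCoeffs

variable {p q : ℤ[X]}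

theorem one : NonnegCoeffs 1 := fun j => by
  rw [coeff_one]; split_ifs <;> norm_num

theorem add (hp : NonnegCoeffs p) (hq : NonnegCoeffs q) : NonnegCoeffs (p + q) := fun j => by
  rw [coeff_add]; exact add_nonneg (hp j) (hq j)

theorem mul (hp : NonnegCoeffs p) (hq : NonnegCoeffs q) : NonnegCoeffs (p * q) := fun j => by
  rw [coeff_mul]; exact Finset.sum_nonneg fun x _ => mul_nonneg (hp _) (hq _)

theorem X_mul (hp : NonnegCoeffs p) : NonnegCoeffs (X * p) :=
  mul (fun j => by rw [coeff_X]; split_ifs <;> norm_num) hp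

theorem natCast_mul (n : ℕ) (hp : NonnegCoeffs p) : NonnegCoeffs ((n : ℤ[X]) * p) :=
  mul (fun j => by rw [← Polynomial.C_eq_natCast, coeff_C]; split_ifs <;> simp) hp

theorem sum {ι : Type*} {s : Finset ι} {f : ι → ℤ[X]} (h : ∀ i ∈ s, NonnegCoeffs (f i)) :
    NonnegCoeffs (∑ i ∈ s, f i) := fun j => by
  rw [finsetSum_coeff]; exact Finset.sum_nonneg fun i hi => h i hi j

end NonnegCoeffs

section VertexRecursion

variable {V : Type*} [DecidableEq V] {G : SimpleGraph V} {W : Finset V → ℤ[X]}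

/-- The expansion along a vertex of a monomer-dimer sum on the induced subgraphs of `G`, where
a monomer at `u` has weight `1 + (deg u - 1) X` and every dimer has weight `-X`. -/
def VertexExpansion [Fintype V] (G : SimpleGraph V) (W : Finset V → ℤ[X]) : Prop :=
  ∀ (S : Finset V) (u : V), u ∈ S →
    W S = (1 + (((Finset.univ.filter (G.Adj u)).card : ℤ[X]) - 1) * X) * W (S.erase u)
      - X * ∑ w ∈ S.filter (G.Adj u), W ((S.erase u).erase w)

/-- Subtracting one monomer of weight `X` per neighbour of `u` inside `S`, except for `k` of the
neighbours outside `S`. -/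
theorem VertexExpansion.eq_add [Fintype V] (h : VertexExpansion G W) {S O : Finset V} {u : V} (hu : u ∈ S)
    (hO : ∀ y ∈ O, y ∉ S ∧ G.Adj u y) :
    ∃ k : ℕ, W S = W (S.erase u)
      + X * ∑ w ∈ S.filter (G.Adj u), (W (S.erase u) - W ((S.erase u).erase w))
      + ((k : ℤ[X]) + (O.card : ℤ[X]) - 1) * X * W (S.erase u) := by
  have hle : (S.filter (G.Adj u)).card + O.card ≤ (Finset.univ.filter (G.Adj u)).card := by
    rw [← Finset.card_union_of_disjoint]
    · refine Finset.card_le_card fun x hx => ?_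
      simp only [Finset.mem_union, Finset.mem_filter, Finset.mem_univ, true_and] at hx ⊢
      exact hx.elim And.right fun hx => (hO x hx).2
    · rw [Finset.disjoint_left]
      exact fun x hx hx' => (hO x hx').1 (Finset.mem_of_mem_filter _ hx)
  obtain ⟨k, hk⟩ := Nat.exists_eq_add_of_le hle
  refine ⟨k, ?_⟩
  rw [h S u hu, hk, Finset.sum_sub_distrib, Finset.sum_const, nsmul_eq_mul]
  push_cast
  ring

/-- Both the non-negativity of `W S` and its monotonicity under the removal of a vertex with a
neighbour outside `S`. -/
def NonnegMono (G : SimpleGraph V) (W : Finset V → ℤ[X]) (S : Finset V) : Prop :=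
  NonnegCoeffs (W S) ∧
    ∀ u ∈ S, ∀ y ∉ S, G.Adj u y → NonnegCoeffs (W S - W (S.erase u))

theorem NonnegMono.erase_neighbor {S : Finset V} {u w : V} (h : NonnegMono G W (S.erase u))
    (hw : w ∈ S.filter (G.Adj u)) : NonnegCoeffs (W (S.erase u) - W ((S.erase u).erase w)) := by
  obtain ⟨hwS, hadj⟩ := Finset.mem_filter.1 hw
  exact h.2 w (Finset.mem_erase.2 ⟨hadj.ne', hwS⟩) u (Finset.notMem_erase _ _) hadj.symm

/-- If `u` has a neighbour `y` outside `T` and can leave `T` along another path, then a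
monomer of weight `X` can be removed at `u`. -/
theorem nonnegCoeffs_sub_X_mul [Fintype V] (h : VertexExpansion G W) {n : ℕ}
    (ih : ∀ T : Finset V, T.card < n → NonnegMono G W T) {u x : V} (p : G.Walk u x)
    (hp : p.IsPath) : ∀ (T : Finset V) (y : V), T.card < n → u ∈ T → y ∉ T → x ∉ T → G.Adj y u →
      s(y, u) ∉ p.edges → NonnegCoeffs (W T - X * W (T.erase u)) := by
  induction p with
  | nil => intro T y _ hu _ hx; exact absurd hu hx
  | @cons u w x huw q ihq =>
    intro T y hT hu hy hx hyu hyp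
    rw [SimpleGraph.Walk.cons_isPath_iff] at hp
    have hT' : (T.erase u).card < n := (Finset.card_erase_lt_of_mem hu).trans hT
    have hmono := ih _ hT'
    by_cases hw : w ∈ T
    · obtain ⟨k, hk⟩ := h.eq_add (O := {y}) hu (by simpa using ⟨hy, hyu.symm⟩)
      have hwN : w ∈ T.filter (G.Adj u) := Finset.mem_filter.2 ⟨hw, huw⟩
      rw [← Finset.add_sum_erase _ _ hwN] at hk
      have key := ihq hp.1 (T.erase u) u hT' (Finset.mem_erase.2 ⟨huw.ne', hw⟩)
        (Finset.notMem_erase _ _) (fun hx' => hx (Finset.mem_of_mem_erase hx')) huw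
        (fun he => hp.2 (q.fst_mem_support_of_mem_edges he))
      have hrest : NonnegCoeffs (∑ v ∈ (T.filter (G.Adj u)).erase w,
          (W (T.erase u) - W ((T.erase u).erase v))) :=
        NonnegCoeffs.sum fun v hv => hmono.erase_neighbor (Finset.mem_of_mem_erase hv)
      convert (key.add hrest.X_mul).add (hmono.1.X_mul.natCast_mul k) using 1
      rw [hk, Finset.card_singleton]
      push_cast
      ring
    · have hyw : y ≠ w := by
        rintro rfl
        exact hyp (by simp [Sym2.eq_swap])
      obtain ⟨k, hk⟩ := h.eq_add (O := {y, w}) hu (by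
        simpa using ⟨⟨hy, hyu.symm⟩, hw, huw⟩)
      have hrest : NonnegCoeffs (∑ v ∈ T.filter (G.Adj u),
          (W (T.erase u) - W ((T.erase u).erase v))) :=
        NonnegCoeffs.sum fun v hv => hmono.erase_neighbor hv
      convert (hmono.1.add hrest.X_mul).add (hmono.1.X_mul.natCast_mul k) using 1
      rw [hk, Finset.card_pair hyw]
      push_cast
      ring

theorem nonnegMono [Fintype V] (h : VertexExpansion G W) (h0 : W ∅ = 1)
    (hcyc : ∀ v, ∃ w, G.Reachable v w ∧ ∃ c : G.Walk w w, c.IsCycle) (S : Finset V) :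
    NonnegMono G W S := by
  induction hn : S.card using Nat.strong_induction_on generalizing S with
  | _ n ih =>
    have ih' : ∀ T : Finset V, T.card < n → NonnegMono G W T := fun T hT => ih _ hT T rfl
    have hmono : ∀ u ∈ S, NonnegMono G W (S.erase u) := fun u hu =>
      ih' _ (hn ▸ Finset.card_erase_lt_of_mem hu)
    have hdiff : ∀ u ∈ S, ∀ y ∉ S, G.Adj u y → NonnegCoeffs (W S - W (S.erase u)) := by
      intro u hu y hy huy
      obtain ⟨k, hk⟩ := h.eq_add (O := {y}) hu (by simpa using ⟨hy, huy⟩)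
      have hsum : NonnegCoeffs (∑ v ∈ S.filter (G.Adj u),
          (W (S.erase u) - W ((S.erase u).erase v))) :=
        NonnegCoeffs.sum fun v hv => (hmono u hu).erase_neighbor hv
      convert hsum.X_mul.add ((hmono u hu).1.X_mul.natCast_mul k) using 1
      rw [hk, Finset.card_singleton]
      push_cast
      ring
    refine ⟨?_, hdiff⟩
    by_cases hex : ∃ u ∈ S, ∃ y ∉ S, G.Adj u y
    · obtain ⟨u, hu, y, hy, huy⟩ := hex
      simpa using (hdiff u hu y hy huy).add (hmono u hu).1
    push Not at hex
    obtain rfl | ⟨v₀, hv₀⟩ := S.eq_empty_or_nonempty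
    · rw [h0]; exact NonnegCoeffs.one
    have hclosed : ∀ a b : V, G.Reachable a b → a ∈ S → b ∈ S := by
      rintro a b ⟨p⟩
      induction p with
      | nil => exact id
      | cons hab _ ihp => exact fun ha => ihp (by_contra fun hb => hex _ ha _ hb hab)
    obtain ⟨v, hv, c, hc⟩ := hcyc v₀
    replace hv := hclosed _ _ hv hv₀
    cases c with
    | nil => simp at hc
    | @cons _ u _ hvu q =>
      rw [SimpleGraph.Walk.cons_isCycle_iff] at hc
      have huS : u ∈ S := hclosed _ _ hvu.reachable hv
      have huN : u ∈ S.filter (G.Adj v) := Finset.mem_filter.2 ⟨huS, hvu⟩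
      obtain ⟨k, hk⟩ := h.eq_add (O := ∅) hv (by simp)
      rw [← Finset.add_sum_erase _ _ huN] at hk
      have key := nonnegCoeffs_sub_X_mul h ih' q hc.1 (S.erase v) v
        (hn ▸ Finset.card_erase_lt_of_mem hv) (Finset.mem_erase.2 ⟨hvu.ne', huS⟩)
        (Finset.notMem_erase _ _) (Finset.notMem_erase _ _) hvu hc.2
      have hrest : NonnegCoeffs (∑ w ∈ (S.filter (G.Adj v)).erase u,
          (W (S.erase v) - W ((S.erase v).erase w))) :=
        NonnegCoeffs.sum fun w hw => (hmono v hv).erase_neighbor (Finset.mem_of_mem_erase hw)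
      convert (key.add hrest.X_mul).add ((hmono v hv).1.X_mul.natCast_mul k) using 1
      rw [hk, Finset.card_empty]
      push_cast
      ring

end VertexRecursion

theorem List.sum_map_sub_const_mul {ι R : Type*} [CommRing R] (L : List ι) (f g : ι → R) (c : R) :
    (L.map fun i => f i - c * g i).sum = (L.map f).sum - c * (L.map g).sum := by
  induction L with
  | nil => simp
  | cons i L ih => simp only [List.map_cons, List.sum_cons, ih]; ring

section MonomerDimer

variable {V : Type*} [DecidableEq V] {R : Type*} [CommRing R]

/-- The monomer-dimer sum over the matchings of the edges `L` lying inside `S`, with monomer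
weights `b` and dimer weight `-x`. -/
noncomputable def monomerDimer (x : R) (b : V → R) : List (Sym2 V) → Finset V → R
  | [], S => ∏ i ∈ S, b i
  | e :: L, S => monomerDimer x b L S -
      if e.toFinset ⊆ S then x * monomerDimer x b L (S \ e.toFinset) else 0

theorem monomerDimer_empty {x : R} {b : V → R} {L : List (Sym2 V)} :
    monomerDimer x b L ∅ = 1 := by
  induction L with
  | nil => simp [monomerDimer]
  | cons e L ih =>
    have he : ¬ e.toFinset ⊆ ∅ := fun h =>
      Finset.notMem_empty _ (h (Sym2.mem_toFinset.2 e.out_fst_mem))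
    rw [monomerDimer, if_neg he, sub_zero, ih]

theorem monomerDimer_congr {x : R} {b b' : V → R} {L : List (Sym2 V)} {S : Finset V}
    (h : ∀ i ∈ S, b i = b' i) : monomerDimer x b L S = monomerDimer x b' L S := by
  induction L generalizing S with
  | nil => exact Finset.prod_congr rfl h
  | cons e L ih =>
    simp only [monomerDimer, ih h, ih fun i hi => h i (Finset.mem_sdiff.1 hi).1]

theorem monomerDimer_eq_erase {x : R} {b : V → R} {L : List (Sym2 V)} {S : Finset V} {v : V}
    (hv : v ∈ S) : monomerDimer x b L S = b v * monomerDimer x b L (S.erase v) -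
      x * (L.map fun e => if v ∈ e ∧ e.toFinset ⊆ S then
        monomerDimer x b L (S \ e.toFinset) else 0).sum := by
  induction L generalizing S with
  | nil => simp [monomerDimer, Finset.mul_prod_erase _ _ hv]
  | cons e L ih =>
    by_cases hve : v ∈ e
    · have h1 : ¬ e.toFinset ⊆ S.erase v := fun h =>
        Finset.notMem_erase v S (h (Sym2.mem_toFinset.2 hve))
      have h2 : ∀ f : Sym2 V, v ∈ f → ¬ e.toFinset ⊆ S \ f.toFinset := fun f hf h =>
        (Finset.mem_sdiff.1 (h (Sym2.mem_toFinset.2 hve))).2 (Sym2.mem_toFinset.2 hf)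
      have h3 : (L.map fun f => if v ∈ f ∧ f.toFinset ⊆ S then
          monomerDimer x b (e :: L) (S \ f.toFinset) else 0) =
          L.map fun f => if v ∈ f ∧ f.toFinset ⊆ S then
            monomerDimer x b L (S \ f.toFinset) else 0 := by
        refine List.map_congr_left fun f _ => ?_
        split_ifs with hf
        · simp [monomerDimer, h2 f hf.1]
        · rfl
      rw [List.map_cons, List.sum_cons, h3]
      simp only [monomerDimer, h1, h2 e hve, hve, true_and, if_false, sub_zero]
      rw [ih hv]
      split_ifs <;> ring
    · have hve' : v ∉ e.toFinset := fun h => hve (Sym2.mem_toFinset.1 h)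
      have h1 : e.toFinset ⊆ S.erase v ↔ e.toFinset ⊆ S := by
        rw [Finset.subset_erase]; exact and_iff_left hve'
      have h3 : ∀ f : Sym2 V, (if v ∈ f ∧ f.toFinset ⊆ S then
          monomerDimer x b (e :: L) (S \ f.toFinset) else 0) =
          (if v ∈ f ∧ f.toFinset ⊆ S then monomerDimer x b L (S \ f.toFinset) else 0) -
          (if e.toFinset ⊆ S then x else 0) * if v ∈ f ∧ f.toFinset ⊆ S \ e.toFinset then
            monomerDimer x b L ((S \ e.toFinset) \ f.toFinset) else 0 := by
        intro f
        simp only [monomerDimer, Finset.subset_sdiff, sdiff_right_comm S e.toFinset,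
          disjoint_comm (a := f.toFinset)]
        split_ifs <;> first | tauto | ring1
      simp only [List.map_cons, List.sum_cons, h3]
      rw [List.sum_map_sub_const_mul]
      simp only [monomerDimer, h1, hve, false_and, if_false]
      rw [ih hv]
      split_ifs with he
      · rw [ih (Finset.mem_sdiff.2 ⟨hv, hve'⟩), Finset.erase_sdiff_comm]
        ring
      · ring

theorem monomerDimer_update {x : R} {b b' : V → R} {L : List (Sym2 V)} {S : Finset V} {v : V}
    {t : R} (hv : v ∈ S) (hbv : b' v = b v + t) (hb : ∀ i ∈ S, i ≠ v → b' i = b i) :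
    monomerDimer x b' L S = monomerDimer x b L S + t * monomerDimer x b L (S.erase v) := by
  rw [monomerDimer_eq_erase (b := b') hv, monomerDimer_eq_erase (b := b) hv, hbv,
    monomerDimer_congr fun i hi => hb i (Finset.mem_of_mem_erase hi) (Finset.ne_of_mem_erase hi)]
  have : (L.map fun e => if v ∈ e ∧ e.toFinset ⊆ S then
        monomerDimer x b' L (S \ e.toFinset) else 0) = L.map fun e =>
      if v ∈ e ∧ e.toFinset ⊆ S then monomerDimer x b L (S \ e.toFinset) else 0 := by
    refine List.map_congr_left fun e _ => ?_
    split_ifs with he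
    · refine monomerDimer_congr fun i hi => ?_
      obtain ⟨hi, hie⟩ := Finset.mem_sdiff.1 hi
      exact hb i hi fun h => hie (Sym2.mem_toFinset.2 (h ▸ he.1))
    · rfl
  rw [this]
  ring

theorem monomerDimer_update_pair {x : R} {b b' : V → R} {L : List (Sym2 V)} {S : Finset V}
    {u v : V} {t : R} (huv : u ≠ v) (hu : u ∈ S) (hv : v ∈ S) (hbu : b' u = b u + t)
    (hbv : b' v = b v + t) (hb : ∀ i, i ≠ u → i ≠ v → b' i = b i) :
    monomerDimer x b' L S = monomerDimer x b L S + t * monomerDimer x b L (S.erase u) +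
      t * monomerDimer x b L (S.erase v) + t ^ 2 * monomerDimer x b L (S \ {u, v}) := by
  have hS : S \ {u, v} = (S.erase v).erase u := by ext; simp; tauto
  rw [monomerDimer_update (b := Function.update b u (b u + t)) (t := t) hv,
    monomerDimer_update (b := b) (b' := Function.update b u (b u + t)) (t := t) hu,
    monomerDimer_update (b := b) (b' := Function.update b u (b u + t)) (t := t) (v := u)
      (S := S.erase v), hS]
  · ring
  · exact Finset.mem_erase.2 ⟨huv, hu⟩
  · simp
  · intro i _ hi; simp [hi]
  · simp
  · intro i _ hi; simp [hi]
  · simp [huv.symm, hbv]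
  · intro i _ hi
    by_cases h : i = u
    · subst h; simp [hbu]
    · simp [h, hb i h hi]

end MonomerDimer

theorem degIn_insert {V : Type*} [DecidableEq V] {s : Finset (Sym2 V)} {e : Sym2 V} (he : e ∉ s)
    (i : V) : degIn (insert e s) i = degIn s i + if i ∈ e then 1 else 0 := by
  by_cases h : i ∈ e <;> simp [degIn, Finset.filter_insert, h, he]

theorem pow_card_mul_sum_powerset {V : Type*} [Fintype V] [DecidableEq V] {R : Type*}
    [CommRing R] (x : R) {L : List (Sym2 V)} (hL : L.Nodup) (hdiag : ∀ e ∈ L, ¬ e.IsDiag)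
    (a : V → R) :
    (1 - x) ^ Fintype.card V * ∑ s ∈ L.toFinset.powerset,
        (-x) ^ s.card * ∏ i, (a i - (degIn s i : R)) =
      (1 - x) ^ L.length *
        monomerDimer x (fun i => a i * (1 - x) + x * degIn L.toFinset i) L Finset.univ := by
  induction L generalizing a with
  | nil =>
    simp [monomerDimer, degIn, Finset.prod_mul_distrib, Finset.prod_const, mul_comm]
  | cons e L ih =>
    rw [List.nodup_cons] at hL
    have he : e ∉ L.toFinset := by simpa using hL.1
    replace ih := ih hL.2 fun f hf => hdiag f (List.mem_cons_of_mem _ hf)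
    have hed : ¬ e.IsDiag := hdiag e List.mem_cons_self
    rw [List.toFinset_cons, Finset.sum_powerset_insert he]
    have h1 : ∑ s ∈ L.toFinset.powerset,
        (-x) ^ (insert e s).card * ∏ i, (a i - (degIn (insert e s) i : R)) =
        -x * ∑ s ∈ L.toFinset.powerset,
          (-x) ^ s.card * ∏ i, ((a i - if i ∈ e then 1 else 0) - (degIn s i : R)) := by
      rw [Finset.mul_sum]
      refine Finset.sum_congr rfl fun s hs => ?_
      have hes : e ∉ s := fun h => he (Finset.mem_powerset.1 hs h)
      rw [Finset.card_insert_of_notMem hes, pow_succ', mul_assoc]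
      congr 2
      refine Finset.prod_congr rfl fun i _ => ?_
      rw [degIn_insert hes]
      push_cast
      ring
    rw [h1, mul_add, mul_left_comm, ih, ih]
    induction e using Sym2.ind with | _ u v
    have huv : u ≠ v := by simpa using hed
    set b : V → R := fun i => a i * (1 - x) + x * degIn L.toFinset i with hb
    have hsub := monomerDimer_update_pair (x := x) (b := b) (t := -(1 - x)) (L := L)
      (b' := fun i => (a i - if i ∈ s(u, v) then 1 else 0) * (1 - x) + x * degIn L.toFinset i)
      huv (Finset.mem_univ _) (Finset.mem_univ _) (by simp [hb]; ring) (by simp [hb]; ring)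
      (fun i hu hv => by simp [hb, hu, hv])
    have hadd := monomerDimer_update_pair (x := x) (b := b) (t := x) (L := L)
      (b' := fun i => a i * (1 - x) + x * degIn (insert s(u, v) L.toFinset) i)
      huv (Finset.mem_univ _) (Finset.mem_univ _) (by simp [hb, degIn_insert he]; ring)
      (by simp [hb, degIn_insert he]; ring) (fun i hu hv => by simp [hb, degIn_insert he, hu, hv])
    have herase : monomerDimer x (fun i => a i * (1 - x) + x * degIn (insert s(u, v) L.toFinset) i)
        L (Finset.univ \ {u, v}) = monomerDimer x b L (Finset.univ \ {u, v}) :=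
      monomerDimer_congr fun i hi => by
        have hie : i ∉ s(u, v) := by simpa using hi
        simp only [hb, degIn_insert he, if_neg hie, add_zero]
    have huv' : s(u, v).toFinset = {u, v} := by ext; simp
    rw [hsub]
    simp only [monomerDimer, Finset.subset_univ, if_true, List.length_cons, huv']
    rw [hadd, herase]
    ring

theorem SimpleGraph.ConnectedComponent.exists_isCycle_of_card_le {V : Type*} [Fintype V]
    {G : SimpleGraph V} [Fintype G.edgeSet] (K : G.ConnectedComponent)
    (h : Nat.card {v // G.connectedComponentMk v = K} ≤
      (G.edgeFinset.filter fun e => ∀ v ∈ e, G.connectedComponentMk v = K).card) :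
    ∃ w, G.connectedComponentMk w = K ∧ ∃ c : G.Walk w w, c.IsCycle := by
  by_contra! hno
  have hacyc : K.toSimpleGraph.IsAcyclic := by
    intro w c hc
    exact hno w.1 w.2 (c.map K.toSimpleGraph_hom)
      (hc.map Subtype.val_injective)
  have htree : K.toSimpleGraph.IsTree := ⟨K.connected_toSimpleGraph, hacyc⟩
  have hcard := htree.card_edgeFinset
  have hle : (G.edgeFinset.filter fun e => ∀ v ∈ e, G.connectedComponentMk v = K).card ≤
      K.toSimpleGraph.edgeFinset.card := by
    refine (Finset.card_le_card (t := K.toSimpleGraph.edgeFinset.image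
      (Sym2.map Subtype.val)) ?_).trans Finset.card_image_le
    intro e he
    induction e using Sym2.ind with | _ a b
    simp only [Finset.mem_filter, SimpleGraph.mem_edgeFinset, SimpleGraph.mem_edgeSet] at he
    refine Finset.mem_image.2 ⟨s(⟨a, he.2 a (by simp)⟩, ⟨b, he.2 b (by simp)⟩), ?_, by simp⟩
    exact SimpleGraph.mem_edgeFinset.2 ((K.toSimpleGraph_adj _ _).2 he.1)
  have : Nat.card {v // G.connectedComponentMk v = K} = Fintype.card K := by
    rw [← Nat.card_eq_fintype_card]; rfl
  omega

theorem exists_reachable_isCycle {V : Type*} [Fintype V] (G : SimpleGraph V) [Fintype G.edgeSet]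
    (hcyc : ∀ K : (subSpan G.edgeFinset).ConnectedComponent, 1 ≤ compNullity G.edgeFinset K)
    (v : V) : ∃ w, G.Reachable v w ∧ ∃ c : G.Walk w w, c.IsCycle := by
  have hG : subSpan G.edgeFinset = G := by
    rw [subSpan, SimpleGraph.coe_edgeFinset, SimpleGraph.fromEdgeSet_edgeSet]
  unfold compNullity compEdges compVerts at hcyc
  rw [hG] at hcyc
  have hle := Nat.lt_add_one_iff.1 (Nat.sub_pos_iff_lt.1 (hcyc (G.connectedComponentMk v)))
  obtain ⟨w, hw, hc⟩ := (G.connectedComponentMk v).exists_isCycle_of_card_le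
    (by convert hle)
  exact ⟨w, (SimpleGraph.ConnectedComponent.exact hw).symm, hc⟩

theorem degIn_edgeFinset {V : Type*} [Fintype V] (G : SimpleGraph V) [Fintype G.edgeSet] (i : V) :
    degIn G.edgeFinset i = (Finset.univ.filter (G.Adj i)).card := by
  unfold degIn
  refine (Finset.card_bij (fun w _ => s(i, w)) ?_ ?_ ?_).symm
  · intro w hw
    simpa using hw
  · intro w _ w' _ h
    exact Sym2.congr_right.1 h
  · intro e he
    obtain ⟨he, hie⟩ := Finset.mem_filter.1 he
    obtain ⟨w, rfl⟩ := hie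
    exact ⟨w, by simpa using he, rfl⟩

theorem vertexExpansion_monomerDimer {V : Type*} [Fintype V] [DecidableEq V] (G : SimpleGraph V)
    [Fintype G.edgeSet] :
    VertexExpansion G (monomerDimer X
      (fun i => 1 * (1 - X) + X * (degIn G.edgeFinset i : ℤ[X])) G.edgeFinset.toList) := by
  intro S u hu
  rw [monomerDimer_eq_erase hu, Finset.sum_map_toList, ← degIn_edgeFinset]
  congr 2
  · ring
  · rw [← Finset.sum_filter]
    refine (Finset.sum_bij (fun w _ => s(u, w)) ?_ ?_ ?_ ?_).symm
    · intro w hw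
      obtain ⟨hwS, hadj⟩ := Finset.mem_filter.1 hw
      simp [hadj, Finset.subset_iff, hu, hwS]
    · intro w _ w' _ h
      exact Sym2.congr_right.1 h
    · intro e he
      obtain ⟨he, hue, heS⟩ := Finset.mem_filter.1 he
      obtain ⟨w, rfl⟩ := hue
      exact ⟨w, Finset.mem_filter.2 ⟨heS (by simp), by simpa using he⟩, rfl⟩
    · intro w _
      congr 1
      ext
      simp
      tauto

theorem omega_coeffs_nonneg {V : Type*} [Fintype V] [DecidableEq V]
    (G : SimpleGraph V) [DecidableRel G.Adj]
    (hcyc : ∀ K : (subSpan G.edgeFinset).ConnectedComponent, 1 ≤ compNullity G.edgeFinset K)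
    (P : Polynomial ℤ)
    (hP : (1 - X : Polynomial ℤ) ^ (Fintype.card V) *
            ∑ s ∈ G.edgeFinset.powerset,
              (-X : Polynomial ℤ) ^ s.card * ∏ i : V, (1 - (degIn s i : Polynomial ℤ))
          = (1 - X : Polynomial ℤ) ^ (G.edgeFinset.card) * P) :
    ∀ j : ℕ, 0 ≤ P.coeff j := by
  have hone : (1 - X : ℤ[X]) ≠ 0 := fun h => by simpa using congrArg (eval 0) h
  have hsum := pow_card_mul_sum_powerset (X : ℤ[X]) G.edgeFinset.nodup_toList
    (fun e he => G.not_isDiag_of_mem_edgeFinset (Finset.mem_toList.1 he)) (fun _ => 1)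
  rw [Finset.toList_toFinset, Finset.length_toList] at hsum
  have hP' : P = monomerDimer X (fun i => 1 * (1 - X) + X * (degIn G.edgeFinset i : ℤ[X]))
      G.edgeFinset.toList Finset.univ :=
    mul_left_cancel₀ (pow_ne_zero _ hone) (hP.symm.trans hsum)
  rw [hP']
  exact (nonnegMono (vertexExpansion_monomerDimer G) monomerDimer_empty
    (exists_reachable_isCycle G hcyc) _).1
end
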